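/- Let G be 3-edge-connected with DFS tree T rooted at r, and let u, v be vertices with v ≠ r, u a descendant of v, and B(v) = B(u) ⊔ {e} for a back-edge e = (x,y). Then M(u) ∈ {M̃(v), M_low1(v), M_low2(v)}. In particular, either (1) M(u) = M̃(v) and e = (M(v), l1(M(v))), or (2) M(u) = M_low1(v) and e = (M_low2(v), l1(M_low2(v))), or (3) M(u) = M_low2(v) and e = (M_low1(v), l1(M_low1(v))). -/

import Mathlib

/-- An undirected multigraph `G` (parallel edges allowed, no self-loops) together with a
DFS spanning tree `T` rooted at `root`, where the vertices are identified with their DFS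
preorder numbers (so they are `Fin n`, and the root gets the smallest number).
Tree edges are oriented from child to parent and back-edges from descendant to
(proper) ancestor. -/
structure DFSGraph where
  /-- number of vertices; the vertices are `Fin n`, numbered in DFS preorder -/
  n : ℕ
  /-- the type indexing the edges (parallel edges are allowed) -/
  Edge : Type
  edgeFintype : Fintype Edge
  /-- the first endpoint (the descendant end) of each edge -/
  fst : Edge → Fin n
  /-- the second endpoint (the ancestor end) of each edge -/
  snd : Edge → Fin n
  /-- no self-loops -/
  noloop : ∀ e, fst e ≠ snd e
  /-- the root `r` of the DFS tree -/
  root : Fin n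
  /-- in DFS preorder the root gets the smallest number -/
  root_le : ∀ v, root ≤ v
  /-- the parent function `p` of the DFS tree (arbitrary at the root) -/
  parent : Fin n → Fin n
  /-- the parent of a non-root vertex precedes it in preorder -/
  parent_lt : ∀ v, v ≠ root → parent v < v
  /-- `tEdge v` is the tree edge `(v, p(v))`, for `v ≠ root` -/
  tEdge : Fin n → Edge
  tEdge_fst : ∀ v, v ≠ root → fst (tEdge v) = v
  tEdge_snd : ∀ v, v ≠ root → snd (tEdge v) = parent v
  tEdge_inj : ∀ u v, u ≠ root → v ≠ root → tEdge u = tEdge v → u = v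
  /-- DFS property: every non-tree edge is a back-edge, i.e. it joins a vertex to an
  ancestor of it (a proper ancestor, by `noloop`) -/
  back_anc : ∀ e, (¬ ∃ v, v ≠ root ∧ e = tEdge v) →
    Relation.ReflTransGen (fun x y => x ≠ root ∧ y = parent x) (fst e) (snd e)
  /-- preorder property: the descendants of any vertex form an interval of preorder
  numbers starting at that vertex -/
  preorder_interval : ∀ v u w : Fin n, v ≤ u → u ≤ w →
    Relation.ReflTransGen (fun x y => x ≠ root ∧ y = parent x) w v →
    Relation.ReflTransGen (fun x y => x ≠ root ∧ y = parent x) u v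

namespace DFSGraph

variable (G : DFSGraph)

/-- `Anc a b`: `a` is an ancestor of `b` in `T` (every vertex is an ancestor of itself). -/
def Anc (a b : Fin G.n) : Prop :=
  Relation.ReflTransGen (fun x y => x ≠ G.root ∧ y = G.parent x) b a

/-- `PAnc a b`: `a` is a proper ancestor of `b` in `T`. -/
def PAnc (a b : Fin G.n) : Prop := G.Anc a b ∧ a ≠ b

/-- `e` is an edge of the spanning tree `T`. -/
def IsTreeEdge (e : G.Edge) : Prop := ∃ v, v ≠ G.root ∧ e = G.tEdge v

/-- `e` is a back-edge (an edge of `G ∖ T`). -/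
def IsBack (e : G.Edge) : Prop := ¬ G.IsTreeEdge e

/-- `B v`: the set of back-edges `(x, y)` with `x` a descendant of `v` and `y` a proper
ancestor of `v`. -/
def B (v : Fin G.n) : Set G.Edge :=
  {e | G.IsBack e ∧ G.Anc v (G.fst e) ∧ G.PAnc (G.snd e) v}

/-- `b_count(v) = |B(v)|`. -/
noncomputable def bcount (v : Fin G.n) : ℕ := (G.B v).ncard

/-- adjacency in `G` after removing the edge set `S` -/
def AdjOff (S : Set G.Edge) (x y : Fin G.n) : Prop :=
  ∃ e, e ∉ S ∧ ((G.fst e = x ∧ G.snd e = y) ∨ (G.fst e = y ∧ G.snd e = x))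

/-- `G ∖ S` is connected -/
def ConnectedOff (S : Set G.Edge) : Prop :=
  ∀ x y, Relation.ReflTransGen (G.AdjOff S) x y

/-- `S` is an edge cut of `G`: removing `S` disconnects `G`. -/
def IsCut (S : Set G.Edge) : Prop := ¬ G.ConnectedOff S

/-- `G` is `k`-edge-connected: it has no cut of fewer than `k` edges. -/
def EdgeConn (k : ℕ) : Prop := ∀ S : Set G.Edge, S.ncard < k → ¬ G.IsCut S

/-- `IsLow1 v y`: `y = low1(v) = min {y | ∃ (x,y) ∈ B(v)}`. -/
def IsLow1 (v y : Fin G.n) : Prop :=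
  (∃ e ∈ G.B v, G.snd e = y) ∧ ∀ e ∈ G.B v, y ≤ G.snd e

/-- `IsHigh v y`: `y = high(v) = max {y | ∃ (x,y) ∈ B(v)}`. -/
def IsHigh (v y : Fin G.n) : Prop :=
  (∃ e ∈ G.B v, G.snd e = y) ∧ ∀ e ∈ G.B v, G.snd e ≤ y

/-- `IsLow2 v y`: `y = low2(v)`, the minimum lower end of the back-edges in `B(v)` minus
one (fixed, but arbitrary) back-edge `(low1D(v), low1(v))` attaining `low1(v)`. -/
def IsLow2 (v y : Fin G.n) : Prop :=
  ∃ f ∈ G.B v, (∀ g ∈ G.B v, G.snd f ≤ G.snd g) ∧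
    (∃ e ∈ G.B v, e ≠ f ∧ G.snd e = y) ∧
    (∀ e ∈ G.B v, e ≠ f → y ≤ G.snd e)

/-- `IsL1 v y`: `y = l1(v) = min ({y | (v,y) is a back-edge} ∪ {v})`. -/
def IsL1 (v y : Fin G.n) : Prop :=
  (y = v ∨ ∃ e, G.IsBack e ∧ G.fst e = v ∧ G.snd e = y) ∧
  y ≤ v ∧ (∀ e, G.IsBack e → G.fst e = v → y ≤ G.snd e)

/-- `IsL2 v y`: `y = l2(v)`, defined as `l1(v)` but after removing one (fixed, but
arbitrary) back-edge `(v, l1(v))` attaining `l1(v)`, if such a back-edge exists. -/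
def IsL2 (v y : Fin G.n) : Prop :=
  ((¬ ∃ e, G.IsBack e ∧ G.fst e = v) ∧ y = v) ∨
  (∃ f, G.IsBack f ∧ G.fst f = v ∧
    (∀ g, G.IsBack g → G.fst g = v → G.snd f ≤ G.snd g) ∧
    (y = v ∨ ∃ e, G.IsBack e ∧ G.fst e = v ∧ e ≠ f ∧ G.snd e = y) ∧
    y ≤ v ∧
    (∀ e, G.IsBack e → G.fst e = v → e ≠ f → y ≤ G.snd e))

/-- `z` is the nearest common ancestor of the set of vertices `S`. -/
def IsNCA (S : Set (Fin G.n)) (z : Fin G.n) : Prop :=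
  (∀ x ∈ S, G.Anc z x) ∧ ∀ z', (∀ x ∈ S, G.Anc z' x) → G.Anc z' z

/-- `IsM v m`: `m = M(v)`, the nearest common ancestor of all higher ends of back-edges
in `B(v)`. -/
def IsM (v m : Fin G.n) : Prop :=
  G.IsNCA {x | ∃ e ∈ G.B v, G.fst e = x} m

/-- `IsMtilde v m`: `m = M̃(v)`, the nearest common ancestor of all higher ends of
back-edges in `B(v)` that are proper descendants of `M(v)` (defined only if such a
higher end exists). -/
def IsMtilde (v m : Fin G.n) : Prop :=
  ∃ mv, G.IsM v mv ∧
    {x | ∃ e ∈ G.B v, G.fst e = x ∧ G.PAnc mv x}.Nonempty ∧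
    G.IsNCA {x | ∃ e ∈ G.B v, G.fst e = x ∧ G.PAnc mv x} m

/-- `c` is a child of `p` in `T`. -/
def IsChild (p c : Fin G.n) : Prop := c ≠ G.root ∧ G.parent c = p

/-- `low1(c) ≤ low1(c')` (stated relationally). -/
def Low1LE (c c' : Fin G.n) : Prop :=
  ∀ y y', G.IsLow1 c y → G.IsLow1 c' y' → y ≤ y'

/-- `c = c₁(p)`: `c` is a `low1` child of `p`, i.e. a child of `p` minimizing `low1`. -/
def IsC1 (p c : Fin G.n) : Prop :=
  G.IsChild p c ∧ ∀ c', G.IsChild p c' → G.Low1LE c c'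

/-- `c = c₂(p)`: `c` is a `low2` child of `p`, i.e. a child of `p` minimizing `low1`
among the children different from the (fixed) `low1` child. -/
def IsC2 (p c : Fin G.n) : Prop :=
  ∃ c1, G.IsC1 p c1 ∧ G.IsChild p c ∧ c ≠ c1 ∧
    ∀ c', G.IsChild p c' → c' ≠ c1 → G.Low1LE c c'

/-- `c = c₃(p)`: `c` is a `low3` child of `p`. -/
def IsC3 (p c : Fin G.n) : Prop :=
  ∃ c1 c2, G.IsC1 p c1 ∧
    (G.IsChild p c2 ∧ c2 ≠ c1 ∧ ∀ c', G.IsChild p c' → c' ≠ c1 → G.Low1LE c2 c') ∧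
    G.IsChild p c ∧ c ≠ c1 ∧ c ≠ c2 ∧
    (∀ c', G.IsChild p c' → c' ≠ c1 → c' ≠ c2 → G.Low1LE c c')

/-- `IsMlow1 v m`: `m = M_low1(v)`, the nearest common ancestor of all higher ends of
back-edges in `B(v)` that are descendants of the `low1` child of `M(v)` (defined only
if such a higher end exists). -/
def IsMlow1 (v m : Fin G.n) : Prop :=
  ∃ mv c1, G.IsM v mv ∧ G.IsC1 mv c1 ∧
    {x | ∃ e ∈ G.B v, G.fst e = x ∧ G.Anc c1 x}.Nonempty ∧
    G.IsNCA {x | ∃ e ∈ G.B v, G.fst e = x ∧ G.Anc c1 x} m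

/-- `IsMlow2 v m`: `m = M_low2(v)`, the nearest common ancestor of all higher ends of
back-edges in `B(v)` that are descendants of the `low2` child of `M(v)` (defined only
if such a higher end exists). -/
def IsMlow2 (v m : Fin G.n) : Prop :=
  ∃ mv c2, G.IsM v mv ∧ G.IsC2 mv c2 ∧
    {x | ∃ e ∈ G.B v, G.fst e = x ∧ G.Anc c2 x}.Nonempty ∧
    G.IsNCA {x | ∃ e ∈ G.B v, G.fst e = x ∧ G.Anc c2 x} m

/-- `IsNextM v w`: `w = nextM(v)`, the maximum vertex `w < v` with `M(w) = M(v)`. -/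
def IsNextM (v w : Fin G.n) : Prop :=
  ∃ m, G.IsM v m ∧ G.IsM w m ∧ w < v ∧ ∀ w', w' < v → G.IsM w' m → w' ≤ w

/-- `IsLowM v l`: `l = low_M(v) = min {y | ∃ (x,y) ∈ B(v) ∖ B(nextM(v))}`. -/
def IsLowM (v l : Fin G.n) : Prop :=
  ∃ w, G.IsNextM v w ∧ (∃ e ∈ G.B v, e ∉ G.B w ∧ G.snd e = l) ∧
    ∀ e ∈ G.B v, e ∉ G.B w → l ≤ G.snd e

end DFSGraph

namespace DFSGraph

variable {G : DFSGraph} {a b c m u v w z : Fin G.n}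

theorem Anc.refl (a : Fin G.n) : G.Anc a a := Relation.ReflTransGen.refl

theorem Anc.trans (hab : G.Anc a b) (hbc : G.Anc b c) : G.Anc a c :=
  Relation.ReflTransGen.trans hbc hab

theorem Anc.le (h : G.Anc a b) : a ≤ b := by
  unfold Anc at h
  induction h with
  | refl => exact le_rfl
  | tail _ hstep ih =>
    obtain ⟨hr, rfl⟩ := hstep
    exact (G.parent_lt _ hr).le.trans ih

theorem Anc.of_le (ha : G.Anc a c) (hb : G.Anc b c) (hab : a ≤ b) : G.Anc a b :=
  G.preorder_interval a b c hab hb.le ha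

theorem Anc.total (ha : G.Anc a c) (hb : G.Anc b c) : G.Anc a b ∨ G.Anc b a :=
  (le_total a b).imp (ha.of_le hb) (hb.of_le ha)

theorem PAnc.lt (h : G.PAnc a b) : a < b := lt_of_le_of_ne h.1.le h.2

theorem PAnc.trans_anc (hab : G.PAnc a b) (hbc : G.Anc b c) : G.PAnc a c :=
  ⟨hab.1.trans hbc, (hab.lt.trans_le hbc.le).ne⟩

theorem Anc.parent_of_ne (h : G.Anc a b) (hne : a ≠ b) :
    b ≠ G.root ∧ G.Anc a (G.parent b) := by
  rcases Relation.ReflTransGen.cases_head h with h | ⟨c, ⟨hr, rfl⟩, hc⟩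
  · exact absurd h.symm hne
  · exact ⟨hr, hc⟩

theorem anc_parent (h : a ≠ G.root) : G.Anc (G.parent a) a :=
  Relation.ReflTransGen.single ⟨h, rfl⟩

theorem IsChild.anc (h : G.IsChild m c) : G.Anc m c := by
  obtain ⟨hr, rfl⟩ := h
  exact anc_parent hr

theorem IsChild.lt (h : G.IsChild m c) : m < c := by
  obtain ⟨hr, rfl⟩ := h
  exact G.parent_lt _ hr

theorem PAnc.exists_child (h : G.PAnc m u) : ∃ c, G.IsChild m c ∧ G.Anc c u := by
  rcases Relation.ReflTransGen.cases_tail h.1 with h' | ⟨c, hc, hr, hp⟩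
  · exact absurd h' h.2
  · exact ⟨c, ⟨hr, hp.symm⟩, hc⟩

theorem IsChild.eq_of_anc (ha : G.IsChild m a) (hb : G.IsChild m b)
    (haz : G.Anc a z) (hbz : G.Anc b z) : a = b := by
  have aux : ∀ {a b}, G.IsChild m a → G.IsChild m b → G.Anc a b → a = b := by
    intro a b ha hb hab
    by_contra hne
    have h := (hab.parent_of_ne hne).2
    rw [hb.2] at h
    exact absurd h.le ha.lt.not_ge
  rcases haz.total hbz with h | h
  · exact aux ha hb h
  · exact (aux hb ha h).symm

theorem exists_isNCA {S : Set (Fin G.n)} (hS : S.Nonempty) (ha : ∀ x ∈ S, G.Anc a x) :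
    ∃ z, G.IsNCA S z := by
  obtain ⟨z, hz, hmax⟩ := Set.exists_max_image {z | ∀ x ∈ S, G.Anc z x} id
    (Set.toFinite _) ⟨a, ha⟩
  obtain ⟨x, hx⟩ := hS
  exact ⟨z, hz, fun z' hz' => (hz' x hx).of_le (hz x hx) (hmax z' hz')⟩

theorem isNCA_singleton (x : Fin G.n) : G.IsNCA {x} x :=
  ⟨fun _ h => h ▸ Anc.refl x, fun _ h => h x rfl⟩

theorem IsLow1.eq (ha : G.IsLow1 c a) (hb : G.IsLow1 c b) : a = b := by
  obtain ⟨⟨e, he, rfl⟩, hea⟩ := ha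
  obtain ⟨⟨f, hf, rfl⟩, hfb⟩ := hb
  exact le_antisymm (hea f hf) (hfb e he)

theorem low1LE_refl (c : Fin G.n) : G.Low1LE c c := fun _ _ h h' => (h.eq h').le

theorem low1LE_total (a b : Fin G.n) : G.Low1LE a b ∨ G.Low1LE b a := by
  by_contra! h
  obtain ⟨hab, hba⟩ := h
  apply hab
  intro y y' hy hy'
  by_contra hlt
  exact hba fun z z' hz hz' => by rw [hz.eq hy', hz'.eq hy]; exact (not_le.mp hlt).le

/-- If two children of `m` are the only ones with a back-edge ending below the bound `v`,
then they are the `low1` and `low2` children of `m`. -/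
theorem isC1_isC2_of_low (ha : G.IsChild m a) (hb : G.IsChild m b) (hab : a ≠ b)
    (hla : ∃ f ∈ G.B a, G.snd f < v) (hlb : ∃ f ∈ G.B b, G.snd f < v)
    (hother : ∀ c, G.IsChild m c → c ≠ a → c ≠ b → ∀ f ∈ G.B c, v ≤ G.snd f) :
    (G.IsC1 m a ∧ G.IsC2 m b) ∨ (G.IsC1 m b ∧ G.IsC2 m a) := by
  have low : ∀ {d}, (∃ f ∈ G.B d, G.snd f < v) →
      ∀ c, G.IsChild m c → c ≠ a → c ≠ b → G.Low1LE d c := by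
    rintro d ⟨f, hf, hfv⟩ c hc hca hcb y y' hy ⟨⟨g, hg, rfl⟩, -⟩
    exact (hy.2 f hf).trans (hfv.le.trans (hother c hc hca hcb g hg))
  rcases low1LE_total a b with h | h
  · have h1 : G.IsC1 m a := by
      refine ⟨ha, fun c hc => ?_⟩
      by_cases hca : c = a
      · exact hca ▸ low1LE_refl c
      by_cases hcb : c = b
      · exact hcb ▸ h
      exact low hla c hc hca hcb
    refine Or.inl ⟨h1, a, h1, hb, hab.symm, fun c hc hca => ?_⟩
    by_cases hcb : c = b
    · exact hcb ▸ low1LE_refl c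
    exact low hlb c hc hca hcb
  · have h1 : G.IsC1 m b := by
      refine ⟨hb, fun c hc => ?_⟩
      by_cases hcb : c = b
      · exact hcb ▸ low1LE_refl c
      by_cases hca : c = a
      · exact hca ▸ h
      exact low hlb c hc hca hcb
    refine Or.inr ⟨h1, b, h1, ha, hab, fun c hc hcb => ?_⟩
    by_cases hca : c = a
    · exact hca ▸ low1LE_refl c
    exact low hla c hc hca hcb

/-- An edge leaving the subtree of `v` is the parent edge of `v` or belongs to `B v`. -/
theorem eq_tEdge_or_mem_B_of_leaves {f : G.Edge}
    (h : ¬ (G.Anc v (G.fst f) ↔ G.Anc v (G.snd f))) : f = G.tEdge v ∨ f ∈ G.B v := by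
  by_cases hf : G.IsTreeEdge f
  · obtain ⟨w, hw, rfl⟩ := hf
    rw [G.tEdge_fst w hw, G.tEdge_snd w hw] at h
    left
    by_cases hvw : v = w
    · rw [hvw]
    · exact absurd ⟨fun h' => (h'.parent_of_ne hvw).2, fun h' => h'.trans (anc_parent hw)⟩ h
  · have hanc : G.Anc (G.snd f) (G.fst f) := G.back_anc f hf
    have hfst : G.Anc v (G.fst f) := by
      by_contra h'
      exact h ⟨fun k => absurd k h', fun k => k.trans hanc⟩
    have hsnd : ¬ G.Anc v (G.snd f) := fun h' => h ⟨fun _ => h', fun _ => hfst⟩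
    exact Or.inr ⟨hf, hfst, (hanc.total hfst).resolve_right hsnd,
      fun h' => hsnd (h' ▸ Anc.refl _)⟩

theorem isCut_insert_tEdge_B (hv : v ≠ G.root) : G.IsCut (insert (G.tEdge v) (G.B v)) := by
  intro hcon
  have inv : ∀ x, Relation.ReflTransGen (G.AdjOff (insert (G.tEdge v) (G.B v))) v x →
      G.Anc v x := by
    intro x hx
    induction hx with
    | refl => exact Anc.refl v
    | tail _ hstep ih =>
      obtain ⟨f, hf, h⟩ := hstep
      have hiff : G.Anc v (G.fst f) ↔ G.Anc v (G.snd f) := by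
        by_contra h'
        exact hf (eq_tEdge_or_mem_B_of_leaves h')
      rcases h with ⟨rfl, rfl⟩ | ⟨rfl, rfl⟩
      · exact hiff.mp ih
      · exact hiff.mpr ih
  exact hv (le_antisymm (inv _ (hcon v G.root)).le (G.root_le v))

theorem EdgeConn.B_nonempty_of_insert (h3 : G.EdgeConn 3) (hv : v ≠ G.root) {e : G.Edge}
    {S : Set G.Edge} (hB : G.B v = insert e S) : S.Nonempty := by
  rw [Set.nonempty_iff_ne_empty]
  rintro rfl
  refine h3 (insert (G.tEdge v) (G.B v)) ?_ (isCut_insert_tEdge_B hv)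
  rw [hB, insert_empty_eq]
  exact (Set.ncard_insert_le _ _).trans_lt (by simp)

end DFSGraph

/-- Lemma 3.2: Let `G` be `3`-edge-connected with DFS tree `T` rooted
at `r`, and let `u, v` be vertices with `v ≠ r`, `u` a descendant of `v`, and
`B(v) = B(u) ⊔ {e}` for a back-edge `e = (x,y)`. Then
`M(u) ∈ {M̃(v), M_low1(v), M_low2(v)}`; in particular, either
(1) `M(u) = M̃(v)` and `e = (M(v), l1(M(v)))`, or
(2) `M(u) = M_low1(v)` and `e = (M_low2(v), l1(M_low2(v)))`, or
(3) `M(u) = M_low2(v)` and `e = (M_low1(v), l1(M_low1(v)))`. -/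
theorem stmt6 (G : DFSGraph) (h3 : G.EdgeConn 3) (u v : Fin G.n)
    (hv : v ≠ G.root) (hanc : G.Anc v u) (e : G.Edge)
    (he : G.IsBack e) (heu : e ∉ G.B u) (hB : G.B v = insert e (G.B u)) :
    ∃ mu, G.IsM u mu ∧
      ((G.IsMtilde v mu ∧ ∃ mv, G.IsM v mv ∧ G.fst e = mv ∧ G.IsL1 mv (G.snd e)) ∨
       (G.IsMlow1 v mu ∧ ∃ m2, G.IsMlow2 v m2 ∧ G.fst e = m2 ∧ G.IsL1 m2 (G.snd e)) ∨
       (G.IsMlow2 v mu ∧ ∃ m1, G.IsMlow1 v m1 ∧ G.fst e = m1 ∧ G.IsL1 m1 (G.snd e))) := by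
  obtain ⟨g, hg⟩ := h3.B_nonempty_of_insert hv hB
  have heB : e ∈ G.B v := hB ▸ Set.mem_insert e _
  have hsub : ∀ f ∈ G.B u, f ∈ G.B v := fun f hf => hB ▸ Set.mem_insert_of_mem e hf
  have hcases : ∀ f ∈ G.B v, f = e ∨ f ∈ G.B u := fun f hf => by rwa [hB] at hf
  obtain ⟨-, hvx, hyv⟩ := id heB
  have hux : ¬ G.Anc u (G.fst e) := fun h => heu ⟨he, h, hyv.trans_anc hanc⟩
  obtain ⟨mu, hmu⟩ : ∃ mu, G.IsM u mu :=
    DFSGraph.exists_isNCA (a := u) ⟨_, g, hg, rfl⟩ (by rintro _ ⟨f, hf, rfl⟩; exact hf.2.1)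
  have humu : G.Anc u mu := hmu.2 u (by rintro _ ⟨f, hf, rfl⟩; exact hf.2.1)
  have hl1 : G.IsL1 (G.fst e) (G.snd e) := by
    refine ⟨Or.inr ⟨e, he, rfl, rfl⟩, (hyv.lt.trans_le hvx.le).le, fun f hf hfx => ?_⟩
    by_contra! hlt
    have hfv : f ∈ G.B v := by
      have hanc' : G.Anc (G.snd f) (G.fst f) := G.back_anc f hf
      have hvf : G.Anc v (G.fst f) := hfx ▸ hvx
      have hlt' := hlt.trans hyv.lt
      exact ⟨hf, hvf, hanc'.of_le hvf hlt'.le, hlt'.ne⟩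
    rcases hcases f hfv with rfl | h
    · exact lt_irrefl _ hlt
    · exact hux (hfx ▸ h.2.1)
  refine ⟨mu, hmu, ?_⟩
  by_cases hxu : G.Anc (G.fst e) u
  · have hM : G.IsM v (G.fst e) := by
      refine ⟨?_, fun z hz => hz _ ⟨e, heB, rfl⟩⟩
      rintro _ ⟨f, hf, rfl⟩
      rcases hcases f hf with rfl | h
      · exact DFSGraph.Anc.refl _
      · exact hxu.trans h.2.1
    have hset : {x | ∃ f ∈ G.B v, G.fst f = x ∧ G.PAnc (G.fst e) x} =
        {x | ∃ f ∈ G.B u, G.fst f = x} := by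
      ext x
      constructor
      · rintro ⟨f, hf, rfl, hp⟩
        rcases hcases f hf with rfl | h
        · exact absurd rfl hp.2
        · exact ⟨f, h, rfl⟩
      · rintro ⟨f, hf, rfl⟩
        exact ⟨f, hsub f hf, rfl, hxu.trans hf.2.1, fun h => hux (h ▸ hf.2.1)⟩
    exact Or.inl ⟨⟨G.fst e, hM, hset ▸ ⟨_, g, hg, rfl⟩, hset ▸ hmu⟩, G.fst e, hM, rfl, hl1⟩
  · obtain ⟨m, hm, hm'⟩ : ∃ m, G.IsNCA {G.fst e, u} m :=
      DFSGraph.exists_isNCA (a := v) ⟨u, by simp⟩ (by simp [hvx, hanc])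
    have hmx : G.Anc m (G.fst e) := hm _ (by simp)
    have hmu' : G.Anc m u := hm _ (by simp)
    have hvm : G.Anc v m := hm' v (by simp [hvx, hanc])
    have hM : G.IsM v m := by
      constructor
      · rintro _ ⟨f, hf, rfl⟩
        rcases hcases f hf with rfl | h
        · exact hmx
        · exact hmu'.trans h.2.1
      · intro z hz
        have hzx : G.Anc z (G.fst e) := hz _ ⟨e, heB, rfl⟩
        have hzu : G.Anc z u := by
          have hzmu : G.Anc z mu :=
            hmu.2 z (by rintro _ ⟨f, hf, rfl⟩; exact hz _ ⟨f, hsub f hf, rfl⟩)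
          exact (hzmu.total humu).resolve_right fun h => hux (h.trans hzx)
        exact hm' z (by simp [hzx, hzu])
    obtain ⟨a, ha, hax⟩ := DFSGraph.PAnc.exists_child ⟨hmx, fun h => hxu (h ▸ hmu')⟩
    obtain ⟨b, hb, hbu⟩ := DFSGraph.PAnc.exists_child ⟨hmu', fun h => hux (h ▸ hmx)⟩
    have hab : a ≠ b := by
      rintro rfl
      exact absurd (hm' a (by simp [hax, hbu])).le ha.lt.not_ge
    have hseta : {x | ∃ f ∈ G.B v, G.fst f = x ∧ G.Anc a x} = {G.fst e} := by
      ext x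
      constructor
      · rintro ⟨f, hf, rfl, hp⟩
        rcases hcases f hf with rfl | h
        · rfl
        · exact absurd (ha.eq_of_anc hb hp (hbu.trans h.2.1)) hab
      · rintro rfl
        exact ⟨e, heB, rfl, hax⟩
    have hsetb : {x | ∃ f ∈ G.B v, G.fst f = x ∧ G.Anc b x} =
        {x | ∃ f ∈ G.B u, G.fst f = x} := by
      ext x
      constructor
      · rintro ⟨f, hf, rfl, hp⟩
        rcases hcases f hf with rfl | h
        · exact absurd (ha.eq_of_anc hb hax hp) hab
        · exact ⟨f, h, rfl⟩
      · rintro ⟨f, hf, rfl⟩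
        exact ⟨f, hsub f hf, rfl, hbu.trans hf.2.1⟩
    have hna : {x | ∃ f ∈ G.B v, G.fst f = x ∧ G.Anc a x}.Nonempty := ⟨_, e, heB, rfl, hax⟩
    have hnb : {x | ∃ f ∈ G.B v, G.fst f = x ∧ G.Anc b x}.Nonempty :=
      ⟨_, g, hsub g hg, rfl, hbu.trans hg.2.1⟩
    have hncaa : G.IsNCA {x | ∃ f ∈ G.B v, G.fst f = x ∧ G.Anc a x} (G.fst e) :=
      hseta ▸ DFSGraph.isNCA_singleton _
    have hncab : G.IsNCA {x | ∃ f ∈ G.B v, G.fst f = x ∧ G.Anc b x} mu := hsetb ▸ hmu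
    have hother : ∀ c, G.IsChild m c → c ≠ a → c ≠ b → ∀ f ∈ G.B c, v ≤ G.snd f := by
      intro c hc hca hcb f hf
      by_contra! hlt
      have hvc : G.Anc v c := hvm.trans hc.anc
      have hfv : f ∈ G.B v :=
        ⟨hf.1, hvc.trans hf.2.1, hf.2.2.1.of_le hvc hlt.le, hlt.ne⟩
      rcases hcases f hfv with rfl | h
      · exact hca (hc.eq_of_anc ha hf.2.1 hax)
      · exact hcb (hc.eq_of_anc hb hf.2.1 (hbu.trans h.2.1))
    have hla : ∃ f ∈ G.B a, G.snd f < v :=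
      ⟨e, ⟨he, hax, hyv.trans_anc (hvm.trans ha.anc)⟩, hyv.lt⟩
    have hgv := hsub g hg
    have hlb : ∃ f ∈ G.B b, G.snd f < v :=
      ⟨g, ⟨hg.1, hbu.trans hg.2.1, hgv.2.2.trans_anc (hvm.trans hb.anc)⟩, hgv.2.2.lt⟩
    rcases DFSGraph.isC1_isC2_of_low ha hb hab hla hlb hother with ⟨h1, h2⟩ | ⟨h1, h2⟩
    · exact Or.inr (Or.inr ⟨⟨m, b, hM, h2, hnb, hncab⟩,
        G.fst e, ⟨m, a, hM, h1, hna, hncaa⟩, rfl, hl1⟩)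
    · exact Or.inr (Or.inl ⟨⟨m, b, hM, h1, hnb, hncab⟩,
        G.fst e, ⟨m, a, hM, h2, hna, hncaa⟩, rfl, hl1⟩)
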